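/- Optimality of myopic sensing for the finite-horizon discounted problem with negatively correlated channels: assume p11 ≤ p01, 0 ≤ β, and β·(ℛ̲ + ℛ̄) ≤ ℛ̲. Then for every t ∈ {1,…,T} and every belief vector ω ∈ [0,1]^N with p01 ≥ ω₁ ≥ ω₂ ≥ … ≥ ω_N ≥ p11, the myopic policy achieves the optimal value: W_t(ω) = V_t(ω). -/

import Mathlib

open Finset

noncomputable section

/-- Belief update map `τ(ω) = ω·p11 + (1-ω)·p01`. -/
def tau (p01 p11 ω : ℝ) : ℝ := ω * p11 + (1 - ω) * p01

/-- Expected one-step reward `R_m(ω; S)` with access cap `m`: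
the expectation of `min(#available, m)` when each channel `i ∈ S` is
independently available with probability `ω i`. -/
def expReward {ι : Type*} [DecidableEq ι] (m : ℕ) (S : Finset ι) (ω : ι → ℝ) : ℝ :=
  ∑ A ∈ S.powerset,
    (∏ i ∈ A, ω i) * (∏ i ∈ S \ A, (1 - ω i)) * ((min A.card m : ℕ) : ℝ)

/-- The set of reward increments `R_m(1,x) − R_m(0,x)` over `x ∈ [lo,hi]^{k'}`
(on `k' + 1` channels). -/
def RdiffSet (lo hi : ℝ) (m k' : ℕ) : Set ℝ :=
  { r : ℝ | ∃ x : Fin k' → ℝ, (∀ i, x i ∈ Set.Icc lo hi) ∧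
      r = expReward m Finset.univ (Fin.cons 1 x) -
          expReward m Finset.univ (Fin.cons 0 x) }

/-- `ℛ̄`: maximal reward increment. -/
def Rbar (lo hi : ℝ) (m k' : ℕ) : ℝ := sSup (RdiffSet lo hi m k')

/-- `ℛ̲`: minimal reward increment. -/
def Rlow (lo hi : ℝ) (m k' : ℕ) : ℝ := sInf (RdiffSet lo hi m k')

/-- The first `k` channels out of `N` (the myopically sensed channels for a
descending-ordered belief vector). -/
def senseSet (N k : ℕ) : Finset (Fin N) := Finset.univ.filter (fun i => (i : ℕ) < k)

/-- Positively correlated case successor belief vector: `c` copies of `p11`,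
then `τ(ω_{k+1}), …, τ(ω_N)`, then `k - c` copies of `p01`. -/
def nextPos (p01 p11 : ℝ) {N : ℕ} (k : ℕ) (ω : Fin N → ℝ) (c : ℕ) : Fin N → ℝ :=
  fun i =>
    if h1 : (i : ℕ) < c then p11
    else if h2 : (i : ℕ) < c + (N - k) then
      tau p01 p11 (ω ⟨k + ((i : ℕ) - c), by have := i.isLt; omega⟩)
    else p01

/-- Negatively correlated case successor belief vector: `k - c` copies of `p01`,
then `τ(ω_N), τ(ω_{N-1}), …, τ(ω_{k+1})` (reversed), then `c` copies of `p11`. -/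
def nextNeg (p01 p11 : ℝ) {N : ℕ} (k : ℕ) (ω : Fin N → ℝ) (c : ℕ) : Fin N → ℝ :=
  fun i =>
    if h1 : (i : ℕ) < k - c then p01
    else if h2 : (i : ℕ) < (k - c) + (N - k) then
      tau p01 p11 (ω ⟨N - 1 - ((i : ℕ) - (k - c)), by have := i.isLt; omega⟩)
    else p11

/-- Myopic value functions for the positively correlated case, indexed by the
number `s` of remaining steps (so `W_t = Wpos (T - t)`). -/
def Wpos (p01 p11 β : ℝ) (N k m : ℕ) : ℕ → (Fin N → ℝ) → ℝ
  | 0, ω => expReward m (senseSet N k) ω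
  | s + 1, ω =>
    expReward m (senseSet N k) ω +
      β * ∑ A ∈ (senseSet N k).powerset,
        (∏ i ∈ A, ω i) * (∏ i ∈ senseSet N k \ A, (1 - ω i)) *
          Wpos p01 p11 β N k m s (nextPos p01 p11 k ω A.card)

/-- Myopic value functions for the negatively correlated case, indexed by the
number `s` of remaining steps (so `W_t = Wneg (T - t)`). -/
def Wneg (p01 p11 β : ℝ) (N k m : ℕ) : ℕ → (Fin N → ℝ) → ℝ
  | 0, ω => expReward m (senseSet N k) ω
  | s + 1, ω =>
    expReward m (senseSet N k) ω +
      β * ∑ A ∈ (senseSet N k).powerset,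
        (∏ i ∈ A, ω i) * (∏ i ∈ senseSet N k \ A, (1 - ω i)) *
          Wneg p01 p11 β N k m s (nextNeg p01 p11 k ω A.card)

/-- Optimal value functions, indexed by the number `s` of remaining steps
(so `V_t = Vopt (T - t)`). -/
def Vopt (p01 p11 β : ℝ) (N k m : ℕ) : ℕ → (Fin N → ℝ) → ℝ
  | 0, ω => sSup { r : ℝ | ∃ π : Finset (Fin N), π.card = k ∧ r = expReward m π ω }
  | s + 1, ω =>
    sSup { r : ℝ | ∃ π : Finset (Fin N), π.card = k ∧
      r = expReward m π ω +
        β * ∑ B ∈ π.powerset,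
          (∏ i ∈ B, ω i) * (∏ i ∈ π \ B, (1 - ω i)) *
            Vopt p01 p11 β N k m s
              (fun j => if j ∈ B then p11 else if j ∈ π then p01 else tau p01 p11 (ω j)) }

/-- The cyclic right shift `(ω_N, ω_1, …, ω_{N-1})`. -/
def cycR {N : ℕ} (ω : Fin N → ℝ) : Fin N → ℝ :=
  fun i =>
    if h : (i : ℕ) = 0 then ω ⟨N - 1, by have := i.isLt; omega⟩
    else ω ⟨(i : ℕ) - 1, by have := i.isLt; omega⟩

/-- The cyclic left shift `(ω_2, ω_3, …, ω_N, ω_1)`. -/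
def cycL {N : ℕ} (ω : Fin N → ℝ) : Fin N → ℝ :=
  fun i =>
    if h : (i : ℕ) + 1 < N then ω ⟨(i : ℕ) + 1, h⟩
    else ω ⟨0, by have := i.isLt; omega⟩

/-- The vector `(ω_1, …, ω_{j-1}, x, y, ω_{j+2}, …, ω_N)` (0-indexed: `x` at
position `j`, `y` at position `j+1`). -/
def swapAt {N : ℕ} (ω : Fin N → ℝ) (j : ℕ) (x y : ℝ) : Fin N → ℝ :=
  fun i => if (i : ℕ) = j then x else if (i : ℕ) = j + 1 then y else ω i

end

/-! ### The number of successes in a list of independent trials -/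

/-- The expectation of `g` of the number of successes in independent trials whose success
probabilities are listed in the first argument. -/
noncomputable def countExp : List ℝ → (ℕ → ℝ) → ℝ
  | [], g => g 0
  | x :: l, g => x * countExp l (fun c => g (c + 1)) + (1 - x) * countExp l g

theorem countExp_perm {l₁ l₂ : List ℝ} (h : l₁.Perm l₂) (g : ℕ → ℝ) :
    countExp l₁ g = countExp l₂ g := by
  induction h generalizing g with
  | nil => rfl
  | cons x _ ih => simp only [countExp, ih]
  | swap x y l => simp only [countExp]; ring
  | trans _ _ ih₁ ih₂ => rw [ih₁, ih₂]

theorem countExp_lincomb (l : List ℝ) (a b : ℝ) (f g : ℕ → ℝ) :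
    countExp l (fun c => a * f c + b * g c) = a * countExp l f + b * countExp l g := by
  induction l generalizing f g with
  | nil => rfl
  | cons x l ih => simp only [countExp, ih]; ring

theorem countExp_sub (l : List ℝ) (f g : ℕ → ℝ) :
    countExp l (fun c => f c - g c) = countExp l f - countExp l g := by
  have := countExp_lincomb l 1 (-1) f g
  simp only [one_mul, neg_mul, ← sub_eq_add_neg] at this
  exact this

theorem countExp_const (l : List ℝ) (a : ℝ) : countExp l (fun _ => a) = a := by
  induction l with
  | nil => rfl
  | cons x l ih => simp only [countExp, ih]; ring

theorem countExp_mono {l : List ℝ} (hl : ∀ v ∈ l, v ∈ Set.Icc (0 : ℝ) 1) {f g : ℕ → ℝ}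
    (h : ∀ c ≤ l.length, f c ≤ g c) : countExp l f ≤ countExp l g := by
  induction l generalizing f g with
  | nil => exact h 0 le_rfl
  | cons x l ih =>
    obtain ⟨hx0, hx1⟩ := hl x List.mem_cons_self
    have hl' : ∀ v ∈ l, v ∈ Set.Icc (0 : ℝ) 1 := fun v hv => hl v (List.mem_cons_of_mem _ hv)
    have i₁ := ih hl' (f := fun c => f (c + 1)) (g := fun c => g (c + 1))
      fun c hc => h (c + 1) (by simpa using hc)
    have i₂ := ih hl' (f := f) (g := g) fun c hc => h c (by simp; omega)
    have := mul_le_mul_of_nonneg_left i₁ hx0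
    have := mul_le_mul_of_nonneg_left i₂ (sub_nonneg.2 hx1)
    simp only [countExp]
    linarith

theorem abs_countExp_sub_le {l : List ℝ} (hl : ∀ v ∈ l, v ∈ Set.Icc (0 : ℝ) 1) {f g : ℕ → ℝ}
    {C : ℝ} (h : ∀ c ≤ l.length, |f c - g c| ≤ C) : |countExp l f - countExp l g| ≤ C := by
  rw [← countExp_sub, abs_le]
  constructor
  · rw [← countExp_const l (-C)]
    exact countExp_mono hl fun c hc => (abs_le.1 (h c hc)).1
  · rw [← countExp_const l C]
    exact countExp_mono hl fun c hc => (abs_le.1 (h c hc)).2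

theorem countExp_append_cons (l₁ l₂ : List ℝ) (x : ℝ) (g : ℕ → ℝ) :
    countExp (l₁ ++ x :: l₂) g =
      x * countExp (l₁ ++ l₂) (fun c => g (c + 1)) + (1 - x) * countExp (l₁ ++ l₂) g :=
  countExp_perm List.perm_middle g

theorem sum_powerset_eq_countExp {ι : Type*} [DecidableEq ι] (l : List ι) (hl : l.Nodup)
    (ω : ι → ℝ) (g : ℕ → ℝ) :
    ∑ A ∈ l.toFinset.powerset, (∏ i ∈ A, ω i) * (∏ i ∈ l.toFinset \ A, (1 - ω i)) * g A.card =
      countExp (l.map ω) g := by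
  induction l generalizing g with
  | nil => simp [countExp]
  | cons a l ih =>
    obtain ⟨ha, hl⟩ := List.nodup_cons.1 hl
    have ha' : a ∉ l.toFinset := by simpa using ha
    rw [List.toFinset_cons, Finset.sum_powerset_insert ha', List.map_cons, countExp, ← ih hl,
      ← ih hl, Finset.mul_sum, Finset.mul_sum, add_comm]
    congr 1
    · refine Finset.sum_congr rfl fun A hA => ?_
      have haA : a ∉ A := fun h => ha' (Finset.mem_powerset.1 hA h)
      rw [Finset.prod_insert haA, Finset.card_insert_of_notMem haA,
        Finset.insert_sdiff_insert, Finset.sdiff_insert_of_notMem ha']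
      ring
    · refine Finset.sum_congr rfl fun A hA => ?_
      have haA : a ∉ A := fun h => ha' (Finset.mem_powerset.1 hA h)
      rw [Finset.insert_sdiff_of_notMem _ haA,
        Finset.prod_insert (fun h => ha' (Finset.mem_sdiff.1 h).1)]
      ring

/-! ### Reward increments -/

/-- The expected marginal reward of one more success, when access is capped at `m`. -/
noncomputable def marginalReward (m : ℕ) (l : List ℝ) : ℝ :=
  countExp l fun c => ((min (c + 1) m : ℕ) : ℝ) - ((min c m : ℕ) : ℝ)

theorem marginalReward_mem_Icc (m : ℕ) {l : List ℝ} (hl : ∀ v ∈ l, v ∈ Set.Icc (0 : ℝ) 1) :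
    marginalReward m l ∈ Set.Icc (0 : ℝ) 1 := by
  constructor
  · rw [← countExp_const l 0]
    refine countExp_mono hl fun c _ => sub_nonneg.2 ?_
    exact_mod_cast min_le_min_right m (Nat.le_succ c)
  · rw [← countExp_const l 1]
    refine countExp_mono hl fun c _ => ?_
    rw [sub_le_iff_le_add]
    norm_cast
    omega

theorem expReward_univ (m n : ℕ) (ω : Fin n → ℝ) :
    expReward m Finset.univ ω = countExp (List.ofFn ω) fun c => ((min c m : ℕ) : ℝ) := by
  rw [List.ofFn_eq_map, ← sum_powerset_eq_countExp _ (List.nodup_finRange n),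
    List.toFinset_finRange, expReward]

theorem expReward_cons_sub (m n : ℕ) (x : Fin n → ℝ) :
    expReward m Finset.univ (Fin.cons 1 x) - expReward m Finset.univ (Fin.cons 0 x) =
      marginalReward m (List.ofFn x) := by
  simp [expReward_univ, countExp, marginalReward, countExp_sub]

theorem marginalReward_mem_RdiffSet {lo hi : ℝ} (m : ℕ) {l : List ℝ}
    (hl : ∀ v ∈ l, v ∈ Set.Icc lo hi) : marginalReward m l ∈ RdiffSet lo hi m l.length :=
  ⟨l.get, fun i => hl _ (l.get_mem i), by rw [expReward_cons_sub, List.ofFn_get]⟩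

theorem RdiffSet_subset_Icc {lo hi : ℝ} (hlo : 0 ≤ lo) (hhi : hi ≤ 1) (m n : ℕ) :
    RdiffSet lo hi m n ⊆ Set.Icc 0 1 := by
  rintro _ ⟨x, hx, rfl⟩
  rw [expReward_cons_sub]
  refine marginalReward_mem_Icc m fun v hv => ?_
  obtain ⟨i, rfl⟩ := List.mem_ofFn.1 hv
  exact ⟨hlo.trans (hx i).1, (hx i).2.trans hhi⟩

theorem Rlow_nonneg {lo hi : ℝ} (hlo : 0 ≤ lo) (hhi : hi ≤ 1) (m n : ℕ) :
    0 ≤ Rlow lo hi m n :=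
  Real.sInf_nonneg fun _ hr => (RdiffSet_subset_Icc hlo hhi m n hr).1

theorem Rbar_nonneg {lo hi : ℝ} (hlo : 0 ≤ lo) (hhi : hi ≤ 1) (m n : ℕ) :
    0 ≤ Rbar lo hi m n :=
  Real.sSup_nonneg fun _ hr => (RdiffSet_subset_Icc hlo hhi m n hr).1

theorem marginalReward_mem_Icc_Rlow_Rbar {lo hi : ℝ} (hlo : 0 ≤ lo) (hhi : hi ≤ 1) (m : ℕ)
    {l : List ℝ} (hl : ∀ v ∈ l, v ∈ Set.Icc lo hi) :
    marginalReward m l ∈ Set.Icc (Rlow lo hi m l.length) (Rbar lo hi m l.length) :=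
  ⟨csInf_le ⟨0, fun _ hr => (RdiffSet_subset_Icc hlo hhi m _ hr).1⟩
      (marginalReward_mem_RdiffSet m hl),
    le_csSup ⟨1, fun _ hr => (RdiffSet_subset_Icc hlo hhi m _ hr).2⟩
      (marginalReward_mem_RdiffSet m hl)⟩

/-! ### The myopic value function on lists of beliefs -/

theorem tau_sub_tau (p01 p11 x y : ℝ) :
    tau p01 p11 x - tau p01 p11 y = (x - y) * (p11 - p01) := by
  simp only [tau]; ring

theorem tau_le_tau {p01 p11 x y : ℝ} (hp : p11 ≤ p01) (h : y ≤ x) :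
    tau p01 p11 x ≤ tau p01 p11 y := by
  have := mul_nonneg (sub_nonneg.2 h) (sub_nonneg.2 hp)
  have := tau_sub_tau p01 p11 x y
  linarith

theorem tau_zero (p01 p11 : ℝ) : tau p01 p11 0 = p01 := by simp [tau]

theorem tau_one (p01 p11 : ℝ) : tau p01 p11 1 = p11 := by simp [tau]

theorem tau_mem_Icc {p01 p11 x : ℝ} (hp : p11 ≤ p01) (hx : x ∈ Set.Icc (0 : ℝ) 1) :
    tau p01 p11 x ∈ Set.Icc p11 p01 := by
  constructor
  · simpa only [tau_one] using tau_le_tau hp hx.2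
  · simpa only [tau_zero] using tau_le_tau hp hx.1

/-- The successor of a belief list whose first `k` entries were sensed with `c` successes and whose
remaining entries are `t`. -/
def nextList (p01 p11 : ℝ) (k : ℕ) (t : List ℝ) (c : ℕ) : List ℝ :=
  List.replicate (k - c) p01 ++ ((t.map (tau p01 p11)).reverse ++ List.replicate c p11)

/-- One step of the myopic policy followed by the continuation value `V`. -/
noncomputable def stepValue (p01 p11 β : ℝ) (k m : ℕ) (V : List ℝ → ℝ) (l : List ℝ) : ℝ :=
  countExp (l.take k) fun c => ((min c m : ℕ) : ℝ) + β * V (nextList p01 p11 k (l.drop k) c)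

/-- The value of the myopic policy over a given number of sensing steps. -/
noncomputable def myopicValue (p01 p11 β : ℝ) (k m : ℕ) : ℕ → List ℝ → ℝ
  | 0 => 0
  | s + 1 => stepValue p01 p11 β k m (myopicValue p01 p11 β k m s)

/-- A belief list with at least `k` entries, all in `I`. -/
def IsBelief (I : Set ℝ) (k : ℕ) (l : List ℝ) : Prop := (∀ v ∈ l, v ∈ I) ∧ k ≤ l.length

/-- `V` is affine in each entry of the list. -/
def EntrywiseAffine (V : List ℝ → ℝ) : Prop :=
  ∀ a b x, V (a ++ x :: b) = x * V (a ++ 1 :: b) + (1 - x) * V (a ++ 0 :: b)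

/-- Putting the larger of two adjacent entries first does not decrease `V`. -/
def ExchangeMono (I : Set ℝ) (k : ℕ) (V : List ℝ → ℝ) : Prop :=
  ∀ a b x y, IsBelief I k (a ++ x :: y :: b) → y ≤ x →
    V (a ++ y :: x :: b) ≤ V (a ++ x :: y :: b)

/-- Moving a single entry to another position changes `V` by at most `C`. -/
def ShiftBound (I : Set ℝ) (k : ℕ) (C : ℝ) (V : List ℝ → ℝ) : Prop :=
  ∀ a z b x, IsBelief I k (a ++ x :: (z ++ b)) →
    |V (a ++ x :: (z ++ b)) - V (a ++ (z ++ x :: b))| ≤ C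

theorem IsBelief.perm {I : Set ℝ} {k : ℕ} {l l' : List ℝ} (h : IsBelief I k l)
    (hl : l.Perm l') : IsBelief I k l' :=
  ⟨fun v hv => h.1 v (hl.mem_iff.2 hv), hl.length_eq ▸ h.2⟩

theorem ExchangeMono.le_move_front {I : Set ℝ} {k : ℕ} {V : List ℝ → ℝ} (hV : ExchangeMono I k V)
    (a z b : List ℝ) (x : ℝ) (h : IsBelief I k (a ++ x :: (z ++ b))) (hz : ∀ v ∈ z, v ≤ x) :
    V (a ++ (z ++ x :: b)) ≤ V (a ++ x :: (z ++ b)) := by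
  induction z generalizing a with
  | nil => exact le_rfl
  | cons v z ih =>
    have h₁ := ih (a ++ [v])
      (h.perm (by simpa using (List.Perm.swap v x (z ++ b)).append_left a))
      fun w hw => hz w (List.mem_cons_of_mem _ hw)
    have h₂ := hV a (z ++ b) x v h (hz v List.mem_cons_self)
    simp only [List.append_assoc, List.cons_append, List.nil_append] at h₁ h₂ ⊢
    exact h₁.trans h₂

theorem ExchangeMono.le_move_back {I : Set ℝ} {k : ℕ} {V : List ℝ → ℝ} (hV : ExchangeMono I k V)
    (a z b : List ℝ) (x : ℝ) (h : IsBelief I k (a ++ x :: (z ++ b))) (hz : ∀ v ∈ z, x ≤ v) :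
    V (a ++ x :: (z ++ b)) ≤ V (a ++ (z ++ x :: b)) := by
  induction z generalizing a with
  | nil => exact le_rfl
  | cons v z ih =>
    have h' : IsBelief I k (a ++ v :: x :: (z ++ b)) :=
      h.perm ((List.Perm.swap v x (z ++ b)).append_left a)
    have h₁ := ih (a ++ [v]) (by simpa using h') fun w hw => hz w (List.mem_cons_of_mem _ hw)
    have h₂ := hV a (z ++ b) v x h' (hz v List.mem_cons_self)
    simp only [List.append_assoc, List.cons_append, List.nil_append] at h₁ h₂ ⊢
    exact h₂.trans h₁

theorem ExchangeMono.le_orderedInsert {I : Set ℝ} {k : ℕ} {V : List ℝ → ℝ}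
    (hV : ExchangeMono I k V) (a l : List ℝ) (x : ℝ) (h : IsBelief I k (a ++ x :: l)) :
    V (a ++ x :: l) ≤ V (a ++ l.orderedInsert (· ≥ ·) x) := by
  induction l generalizing a with
  | nil => exact le_rfl
  | cons v l ih =>
    rw [List.orderedInsert_cons]
    split_ifs with hxv
    · exact le_rfl
    · have h' : IsBelief I k (a ++ v :: x :: l) := h.perm ((List.Perm.swap v x l).append_left a)
      have h₁ := ih (a ++ [v]) (by simpa using h')
      have h₂ := hV a l v x h' (le_of_not_ge hxv)
      simp only [List.append_assoc, List.cons_append, List.nil_append] at h₁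
      exact h₂.trans h₁

theorem ExchangeMono.le_insertionSort {I : Set ℝ} {k : ℕ} {V : List ℝ → ℝ}
    (hV : ExchangeMono I k V) (a l : List ℝ) (h : IsBelief I k (a ++ l)) :
    V (a ++ l) ≤ V (a ++ l.insertionSort (· ≥ ·)) := by
  induction l generalizing a with
  | nil => exact le_rfl
  | cons x l ih =>
    have h₁ := ih (a ++ [x]) (by simpa using h)
    simp only [List.append_assoc, List.cons_append, List.nil_append] at h₁
    exact h₁.trans (hV.le_orderedInsert a _ x
      (h.perm (((List.perm_insertionSort _ l).symm.cons x).append_left a)))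

theorem ExchangeMono.le_of_perm {I : Set ℝ} {k : ℕ} {V : List ℝ → ℝ} (hV : ExchangeMono I k V)
    {l l' : List ℝ} (h : IsBelief I k l) (hl : l.Perm l') (hl' : l'.Pairwise (· ≥ ·)) :
    V l ≤ V l' := by
  have := hV.le_insertionSort [] l (by simpa using h)
  rw [((List.perm_insertionSort _ l).trans hl).eq_of_pairwise'
    (List.pairwise_insertionSort _ l) hl'] at this
  simpa using this

section Step

variable {p01 p11 β : ℝ} {k m : ℕ} {V : List ℝ → ℝ}

theorem nextList_append_cons (a b : List ℝ) (x : ℝ) (c : ℕ) :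
    nextList p01 p11 k (a ++ x :: b) c =
      (List.replicate (k - c) p01 ++ (b.map (tau p01 p11)).reverse) ++
        tau p01 p11 x :: ((a.map (tau p01 p11)).reverse ++ List.replicate c p11) := by
  simp [nextList]

theorem isBelief_nextList (hp : p11 ≤ p01) {t : List ℝ} (ht : ∀ v ∈ t, v ∈ Set.Icc (0 : ℝ) 1)
    (c : ℕ) : IsBelief (Set.Icc p11 p01) k (nextList p01 p11 k t c) := by
  refine ⟨fun v hv => ?_, by simp [nextList]; omega⟩
  simp only [nextList, List.mem_append, List.mem_reverse, List.mem_map, List.mem_replicate] at hv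
  obtain ⟨-, rfl⟩ | ⟨u, hu, rfl⟩ | ⟨-, rfl⟩ := hv
  · exact ⟨hp, le_rfl⟩
  · exact tau_mem_Icc hp (ht u hu)
  · exact ⟨le_rfl, hp⟩

theorem stepValue_append {h t : List ℝ} (hk : h.length = k) :
    stepValue p01 p11 β k m V (h ++ t) =
      countExp h fun c => ((min c m : ℕ) : ℝ) + β * V (nextList p01 p11 k t c) := by
  rw [stepValue, List.take_left' hk, List.drop_left' hk]

theorem exists_append_of_le_length {l : List ℝ} {n : ℕ} (h : n ≤ l.length) :
    ∃ l₁ l₂, l = l₁ ++ l₂ ∧ l₁.length = n :=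
  ⟨l.take n, l.drop n, (List.take_append_drop n l).symm, by simpa using h⟩

theorem EntrywiseAffine.stepValue (hV : EntrywiseAffine V) :
    EntrywiseAffine (stepValue p01 p11 β k m V) := by
  intro a b x
  rcases lt_or_ge a.length k with hk | hk
  · obtain ⟨n, rfl⟩ := Nat.exists_eq_add_of_lt hk
    have ht (y : ℝ) : (a ++ y :: b).take (a.length + n + 1) = a ++ y :: b.take n := by
      rw [add_assoc, List.take_length_add_append, List.take_succ_cons]
    have hd (y : ℝ) : (a ++ y :: b).drop (a.length + n + 1) = b.drop n := by
      rw [add_assoc, List.drop_length_add_append, List.drop_succ_cons]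
    simp only [_root_.stepValue, ht, hd, countExp_append_cons]
    ring
  · obtain ⟨h, a, rfl, hh⟩ := exists_append_of_le_length hk
    simp only [List.append_assoc, stepValue_append hh]
    simp only [nextList_append_cons]
    rw [← countExp_lincomb]
    congr 1
    funext c
    rw [hV _ _ (tau p01 p11 x), hV _ _ (tau p01 p11 1), hV _ _ (tau p01 p11 0)]
    simp only [tau]
    ring

theorem stepValue_perm_append {h h' t : List ℝ} (hh : h.Perm h') (hk : h.length ≤ k) :
    stepValue p01 p11 β k m V (h ++ t) = stepValue p01 p11 β k m V (h' ++ t) := by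
  obtain ⟨n, rfl⟩ := Nat.exists_eq_add_of_le hk
  have e : h.length + n = h'.length + n := by rw [hh.length_eq]
  have ht : ((h ++ t).take (h.length + n)).Perm ((h' ++ t).take (h.length + n)) := by
    nth_rw 2 [e]
    rw [List.take_length_add_append, List.take_length_add_append]
    exact hh.append_right _
  have hd : (h ++ t).drop (h.length + n) = (h' ++ t).drop (h.length + n) := by
    nth_rw 2 [e]
    rw [List.drop_length_add_append, List.drop_length_add_append]
  rw [stepValue, stepValue, countExp_perm ht, hd]

variable {lo hi : ℝ}

theorem abs_countExp_continuation_sub_le (hβ : 0 ≤ β) (hhi : 0 ≤ hi)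
    (hcond : β * (lo + hi) ≤ lo) {h : List ℝ} (hh : ∀ v ∈ h, v ∈ Set.Icc (0 : ℝ) 1)
    (r : ℕ → ℝ) {e e' : ℕ → ℝ} (he : ∀ c ≤ h.length, |e c - e' c| ≤ lo + hi) :
    |countExp h (fun c => r c + β * e c) - countExp h (fun c => r c + β * e' c)| ≤ lo + hi := by
  refine abs_countExp_sub_le hh fun c hc => ?_
  rw [add_sub_add_left_eq_sub, ← mul_sub, abs_mul, abs_of_nonneg hβ]
  linarith [mul_le_mul_of_nonneg_left (he c hc) hβ]

theorem countExp_succ_sub_mem_Icc (hβ : 0 ≤ β) (hcond : β * (lo + hi) ≤ lo) {h : List ℝ}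
    (hh : ∀ v ∈ h, v ∈ Set.Icc (0 : ℝ) 1) (hr : marginalReward m h ∈ Set.Icc lo hi)
    {e e' : ℕ → ℝ} (he : ∀ c ≤ h.length, |e c - e' c| ≤ lo + hi) :
    countExp h (fun c => ((min (c + 1) m : ℕ) : ℝ) + β * e c) -
      countExp h (fun c => ((min c m : ℕ) : ℝ) + β * e' c) ∈ Set.Icc 0 (lo + hi) := by
  have h₁ : |countExp h e - countExp h e'| ≤ lo + hi := abs_countExp_sub_le hh he
  have h₂ : countExp h (fun c => ((min (c + 1) m : ℕ) : ℝ) + β * e c) -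
      countExp h (fun c => ((min c m : ℕ) : ℝ) + β * e' c) =
        marginalReward m h + β * (countExp h e - countExp h e') := by
    have e₁ := countExp_lincomb h 1 β (fun c => ((min (c + 1) m : ℕ) : ℝ)) e
    have e₂ := countExp_lincomb h 1 β (fun c => ((min c m : ℕ) : ℝ)) e'
    simp only [one_mul] at e₁ e₂
    rw [e₁, e₂, marginalReward, countExp_sub]
    ring
  obtain ⟨h₃, h₄⟩ := abs_le.1 h₁
  have h₅ := mul_le_mul_of_nonneg_left h₃ hβ
  have h₆ := mul_le_mul_of_nonneg_left h₄ hβ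
  rw [h₂]
  constructor <;> linarith [hr.1, hr.2]

theorem ExchangeMono.stepValue (h0 : p01 ≤ 1) (h1 : 0 ≤ p11) (hp : p11 ≤ p01) (hβ : 0 ≤ β)
    (hcond : β * (lo + hi) ≤ lo)
    (hr : ∀ h : List ℝ, (∀ v ∈ h, v ∈ Set.Icc p11 p01) → h.length + 1 = k →
      marginalReward m h ∈ Set.Icc lo hi)
    (hA : EntrywiseAffine V) (hE : ExchangeMono (Set.Icc p11 p01) k V)
    (hS : ShiftBound (Set.Icc p11 p01) k (lo + hi) V) :
    ExchangeMono (Set.Icc p11 p01) k (stepValue p01 p11 β k m V) := by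
  have hI {v : ℝ} (hv : v ∈ Set.Icc p11 p01) : v ∈ Set.Icc (0 : ℝ) 1 :=
    Set.Icc_subset_Icc h1 h0 hv
  intro a b x y hb hxy
  rcases lt_trichotomy (a.length + 1) k with hk | hk | hk
  · have := stepValue_perm_append (p01 := p01) (p11 := p11) (β := β) (m := m) (V := V) (k := k)
      (h := a ++ [y, x]) (h' := a ++ [x, y]) (t := b)
      ((List.Perm.swap x y []).append_left a) (by simp; omega)
    simp only [List.append_assoc, List.cons_append, List.nil_append] at this
    exact this.le
  · have ha : ∀ v ∈ a, v ∈ Set.Icc p11 p01 := fun v hv => hb.1 v (List.mem_append_left _ hv)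
    have hbb : ∀ v ∈ b, v ∈ Set.Icc (0 : ℝ) 1 := fun v hv => hI (hb.1 v (by simp [hv]))
    have key : _root_.stepValue p01 p11 β k m V (a ++ 0 :: 1 :: b) ≤
        _root_.stepValue p01 p11 β k m V (a ++ 1 :: 0 :: b) := by
      have e (u v : ℝ) : a ++ u :: v :: b = (a ++ [u]) ++ v :: b := by simp
      rw [e, e, stepValue_append (by simpa using hk), stepValue_append (by simpa using hk),
        countExp_append_cons, countExp_append_cons]
      simp only [List.append_nil, zero_mul, sub_zero, one_mul, zero_add, sub_self, add_zero]
      rw [← sub_nonneg]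
      refine (countExp_succ_sub_mem_Icc hβ hcond (fun v hv => hI (ha v hv)) (hr a ha hk)
        fun c hc => ?_).1
      have hN := isBelief_nextList (k := k) hp (t := 1 :: b)
        (by simpa using hbb) c
      subst hk
      have e₁ : nextList p01 p11 (a.length + 1) (1 :: b) c = [] ++ p01 ::
          ((List.replicate (a.length - c) p01 ++ (b.map (tau p01 p11)).reverse) ++
            p11 :: List.replicate c p11) := by
        simp [nextList, tau_one, Nat.succ_sub hc, List.replicate_succ]
      have e₂ : nextList p01 p11 (a.length + 1) (0 :: b) (c + 1) = [] ++
          ((List.replicate (a.length - c) p01 ++ (b.map (tau p01 p11)).reverse) ++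
            p01 :: p11 :: List.replicate c p11) := by
        simp [nextList, tau_zero, List.replicate_succ]
      rw [e₁] at hN ⊢
      rw [e₂, abs_sub_comm]
      exact hS _ _ _ _ hN
    have hA' := hA.stepValue (p01 := p01) (p11 := p11) (β := β) (k := k) (m := m)
    have bil (u v : ℝ) := hA' (a ++ [u]) b v
    simp only [List.append_assoc, List.cons_append, List.nil_append] at bil
    rw [hA' a _ y, hA' a _ x, bil 1 x, bil 0 x, bil 1 y, bil 0 y]
    nlinarith [mul_le_mul_of_nonneg_left key (sub_nonneg.2 hxy)]
  · obtain ⟨h, a, rfl, hh⟩ := exists_append_of_le_length (Nat.lt_succ_iff.1 hk)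
    simp only [List.append_assoc] at hb ⊢
    rw [stepValue_append hh, stepValue_append hh]
    refine countExp_mono (fun v hv => hI (hb.1 v (List.mem_append_left _ hv))) fun c _ => ?_
    have hN := isBelief_nextList (k := k) hp (t := a ++ x :: y :: b)
      (fun v hv => hI (hb.1 v (List.mem_append_right _ hv))) c
    have e (u v : ℝ) : nextList p01 p11 k (a ++ u :: v :: b) c =
        (List.replicate (k - c) p01 ++ (b.map (tau p01 p11)).reverse) ++
          tau p01 p11 v :: tau p01 p11 u ::
            ((a.map (tau p01 p11)).reverse ++ List.replicate c p11) := by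
      simp [nextList]
    rw [e] at hN ⊢
    rw [e]
    gcongr
    exact hE _ _ _ _ hN (tau_le_tau hp hxy)

theorem abs_bilinear_sub_le {x u C : ℝ} (hx : x ∈ Set.Icc (0 : ℝ) 1) (hu : u ∈ Set.Icc (0 : ℝ) 1)
    {d₁₁ d₁₀ d₀₁ d₀₀ : ℝ} (h₁₁ : |d₁₁| ≤ C) (h₁₀ : |d₁₀| ≤ C) (h₀₁ : |d₀₁| ≤ C)
    (h₀₀ : |d₀₀| ≤ C) :
    |x * (u * d₁₁ + (1 - u) * d₁₀) + (1 - x) * (u * d₀₁ + (1 - u) * d₀₀)| ≤ C := by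
  have conv {w d d' : ℝ} (hw : w ∈ Set.Icc (0 : ℝ) 1) (h : |d| ≤ C) (h' : |d'| ≤ C) :
      |w * d + (1 - w) * d'| ≤ C := by
    rw [abs_le] at *
    have := hw.1
    have := hw.2
    constructor <;> nlinarith
  exact conv hx (conv hu h₁₁ h₁₀) (conv hu h₀₁ h₀₀)

theorem ShiftBound.stepValue (h0 : p01 ≤ 1) (h1 : 0 ≤ p11) (hp : p11 ≤ p01) (hβ : 0 ≤ β)
    (hlo : 0 ≤ lo) (hhi : 0 ≤ hi) (hcond : β * (lo + hi) ≤ lo)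
    (hr : ∀ h : List ℝ, (∀ v ∈ h, v ∈ Set.Icc p11 p01) → h.length + 1 = k →
      marginalReward m h ∈ Set.Icc lo hi)
    (hA : EntrywiseAffine V) (hE : ExchangeMono (Set.Icc p11 p01) k V)
    (hS : ShiftBound (Set.Icc p11 p01) k (lo + hi) V) :
    ShiftBound (Set.Icc p11 p01) k (lo + hi) (stepValue p01 p11 β k m V) := by
  have hI {v : ℝ} (hv : v ∈ Set.Icc p11 p01) : v ∈ Set.Icc (0 : ℝ) 1 :=
    Set.Icc_subset_Icc h1 h0 hv
  intro a z b x hb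
  rcases lt_or_ge (a.length + z.length) k with hk | hk
  · have := stepValue_perm_append (p01 := p01) (p11 := p11) (β := β) (m := m) (V := V) (k := k)
      (h := a ++ x :: z) (h' := a ++ (z ++ [x])) (t := b)
      ((List.perm_append_singleton x z).symm.append_left a) (by simp; omega)
    simp only [List.append_assoc, List.cons_append, List.nil_append] at this
    rw [this, sub_self, abs_zero]
    exact add_nonneg hlo hhi
  rcases lt_or_ge a.length k with hak | hak
  · obtain ⟨z₁, z₂, rfl, hz⟩ := exists_append_of_le_length (l := z)
      (n := k - 1 - a.length) (by omega)
    obtain _ | ⟨u, z⟩ := z₂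
    · simp at hk; omega
    have hh : (a ++ z₁).length + 1 = k := by simp; omega
    have hah : ∀ v ∈ a ++ z₁, v ∈ Set.Icc p11 p01 := by
      intro v hv
      refine hb.1 v ?_
      simp only [List.mem_append, List.mem_cons] at hv ⊢
      tauto
    have hah' : ∀ v ∈ a ++ z₁, v ∈ Set.Icc (0 : ℝ) 1 := fun v hv => hI (hah v hv)
    have hzb : ∀ v ∈ z ++ b, v ∈ Set.Icc (0 : ℝ) 1 := by
      intro v hv
      refine hI (hb.1 v ?_)
      simp only [List.mem_append, List.mem_cons] at hv ⊢
      tauto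
    have hx : x ∈ Set.Icc (0 : ℝ) 1 := hI (hb.1 x (by simp))
    have hu : u ∈ Set.Icc (0 : ℝ) 1 := hI (hb.1 u (by simp))
    have hb0 : (0 : ℝ) ∈ Set.Icc (0 : ℝ) 1 := by simp
    have hb1 : (1 : ℝ) ∈ Set.Icc (0 : ℝ) 1 := by simp
    set S := _root_.stepValue p01 p11 β k m V with hSdef
    set h := a ++ z₁ with hhdef
    have hG1 (j : ℝ) : S (a ++ 1 :: (z₁ ++ j :: (z ++ b))) = countExp h fun c =>
        ((min (c + 1) m : ℕ) : ℝ) + β * V (nextList p01 p11 k (j :: (z ++ b)) (c + 1)) := by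
      rw [← List.cons_append, ← List.append_assoc, hSdef,
        stepValue_append (by simpa [hhdef, add_assoc] using hh), countExp_append_cons]
      simp [hhdef]
    have hG0 (j : ℝ) : S (a ++ 0 :: (z₁ ++ j :: (z ++ b))) = countExp h fun c =>
        ((min c m : ℕ) : ℝ) + β * V (nextList p01 p11 k (j :: (z ++ b)) c) := by
      rw [← List.cons_append, ← List.append_assoc, hSdef,
        stepValue_append (by simpa [hhdef, add_assoc] using hh), countExp_append_cons]
      simp [hhdef]
    have hsplit (i j : ℝ) : a ++ (z₁ ++ j :: (z ++ i :: b)) = (h ++ [j]) ++ (z ++ i :: b) := by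
      simp [hhdef]
    have hF1 (i : ℝ) : S (a ++ (z₁ ++ 1 :: (z ++ i :: b))) = countExp h fun c =>
        ((min (c + 1) m : ℕ) : ℝ) + β * V (nextList p01 p11 k (z ++ i :: b) (c + 1)) := by
      rw [hsplit, hSdef, stepValue_append (by simpa using hh), countExp_append_cons]
      simp
    have hF0 (i : ℝ) : S (a ++ (z₁ ++ 0 :: (z ++ i :: b))) = countExp h fun c =>
        ((min c m : ℕ) : ℝ) + β * V (nextList p01 p11 k (z ++ i :: b) c) := by
      rw [hsplit, hSdef, stepValue_append (by simpa using hh), countExp_append_cons]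
      simp
    set Y := (b.map (tau p01 p11)).reverse with hY
    set Z := (z.map (tau p01 p11)).reverse with hZ
    have hZI : ∀ v ∈ Z, v ∈ Set.Icc p11 p01 := by
      intro v hv
      simp only [hZ, List.mem_reverse, List.mem_map] at hv
      obtain ⟨w, hw, rfl⟩ := hv
      exact tau_mem_Icc hp (hzb w (List.mem_append_left _ hw))
    have hbel {i : ℝ} (hi : i ∈ Set.Icc (0 : ℝ) 1) (c : ℕ) :
        IsBelief (Set.Icc p11 p01) k (nextList p01 p11 k (z ++ i :: b) c) := by
      refine isBelief_nextList hp (fun v hv => ?_) c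
      rcases List.mem_cons.1 (List.perm_middle.mem_iff.1 hv) with rfl | hv
      · exact hi
      · exact hzb v hv
    have habs {d : ℝ} (hd : d ∈ Set.Icc 0 (lo + hi)) : |d| ≤ lo + hi :=
      (abs_of_nonneg hd.1).trans_le hd.2
    have h₁₁ : |S (a ++ 1 :: (z₁ ++ 1 :: (z ++ b))) - S (a ++ (z₁ ++ 1 :: (z ++ 1 :: b)))| ≤
        lo + hi := by
      rw [hG1, hF1]
      refine abs_countExp_continuation_sub_le hβ hhi hcond hah' _ fun c hc => ?_
      have hN := hbel hb1 (c + 1)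
      have e₁ : nextList p01 p11 k (z ++ 1 :: b) (c + 1) =
          (List.replicate (h.length - c) p01 ++ Y) ++
            p11 :: (Z ++ p11 :: List.replicate c p11) := by
        simp [nextList, tau_one, ← hh, List.replicate_succ, hY, hZ]
      have e₂ : nextList p01 p11 k (1 :: (z ++ b)) (c + 1) =
          (List.replicate (h.length - c) p01 ++ Y) ++
            (Z ++ p11 :: p11 :: List.replicate c p11) := by
        simp [nextList, tau_one, ← hh, List.replicate_succ, hY, hZ]
      rw [e₁] at hN ⊢
      rw [e₂, abs_sub_comm]
      exact hS _ _ _ _ hN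
    have h₀₀ : |S (a ++ 0 :: (z₁ ++ 0 :: (z ++ b))) - S (a ++ (z₁ ++ 0 :: (z ++ 0 :: b)))| ≤
        lo + hi := by
      rw [hG0, hF0]
      refine abs_countExp_continuation_sub_le hβ hhi hcond hah' _ fun c hc => ?_
      have hN := hbel hb0 c
      have e₁ : nextList p01 p11 k (z ++ 0 :: b) c =
          (List.replicate (k - c) p01 ++ Y) ++ p01 :: (Z ++ List.replicate c p11) := by
        simp [nextList, tau_zero, hY, hZ]
      have e₂ : nextList p01 p11 k (0 :: (z ++ b)) c =
          (List.replicate (k - c) p01 ++ Y) ++ (Z ++ p01 :: List.replicate c p11) := by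
        simp [nextList, tau_zero, hY, hZ]
      rw [e₁] at hN ⊢
      rw [e₂, abs_sub_comm]
      exact hS _ _ _ _ hN
    have h₀₁ : |S (a ++ 0 :: (z₁ ++ 1 :: (z ++ b))) - S (a ++ (z₁ ++ 1 :: (z ++ 0 :: b)))| ≤
        lo + hi := by
      rw [hG0, hF1, abs_sub_comm]
      refine habs (countExp_succ_sub_mem_Icc hβ hcond hah' (hr h hah hh) fun c hc => ?_)
      have hN := (isBelief_nextList (k := k) hp (t := 1 :: (z ++ b))
        (List.forall_mem_cons.2 ⟨hb1, hzb⟩) c)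
      have e₁ : nextList p01 p11 k (z ++ 0 :: b) (c + 1) =
          [] ++ ((List.replicate (h.length - c) p01 ++ Y) ++
            p01 :: (Z ++ p11 :: List.replicate c p11)) := by
        simp [nextList, tau_zero, ← hh, List.replicate_succ, hY, hZ]
      have e₂ : nextList p01 p11 k (1 :: (z ++ b)) c =
          [] ++ p01 :: ((List.replicate (h.length - c) p01 ++ Y) ++
            (Z ++ p11 :: List.replicate c p11)) := by
        simp [nextList, tau_one, ← hh, List.replicate_succ, hY, hZ, Nat.succ_sub hc]
      rw [e₂] at hN ⊢
      rw [e₁, abs_sub_comm]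
      exact hS _ _ _ _ hN
    have h₁₀ : |S (a ++ 1 :: (z₁ ++ 0 :: (z ++ b))) - S (a ++ (z₁ ++ 0 :: (z ++ 1 :: b)))| ≤
        lo + hi := by
      rw [hG1, hF0]
      refine habs (countExp_succ_sub_mem_Icc hβ hcond hah' (hr h hah hh) fun c hc => ?_)
      have hN := hbel hb1 c
      have e₁ : nextList p01 p11 k (z ++ 1 :: b) c =
          (p01 :: (List.replicate (h.length - c) p01 ++ Y)) ++
            p11 :: (Z ++ List.replicate c p11) := by
        simp [nextList, tau_one, ← hh, List.replicate_succ, hY, hZ, Nat.succ_sub hc]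
      have e₂ : nextList p01 p11 k (0 :: (z ++ b)) (c + 1) =
          [] ++ (((List.replicate (h.length - c) p01 ++ Y) ++ Z) ++
            p01 :: p11 :: List.replicate c p11) := by
        simp [nextList, tau_zero, ← hh, List.replicate_succ, hY, hZ]
      have e₃ : (p01 :: (List.replicate (h.length - c) p01 ++ Y)) ++
            (Z ++ p11 :: List.replicate c p11) =
          [] ++ p01 :: (((List.replicate (h.length - c) p01 ++ Y) ++ Z) ++
            p11 :: List.replicate c p11) := by
        simp
      rw [e₁] at hN ⊢
      rw [e₂]
      have hM := hN.perm (List.perm_middle.symm.append_left _)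
      have i₁ := hE.le_move_back _ _ _ _ hN fun v hv => (hZI v hv).1
      have i₂ := hS _ _ _ _ hN
      rw [e₃] at hM i₁ i₂
      have i₃ := hE.le_move_front _ _ _ _ hM fun v hv => (hM.1 v (by
        simp only [List.nil_append, List.mem_cons, List.mem_append] at hv ⊢
        tauto)).2
      have i₄ := hS _ _ _ _ hM
      rw [abs_le] at i₂ i₄ ⊢
      constructor <;> linarith
    have hA' := hA.stepValue (p01 := p01) (p11 := p11) (β := β) (k := k) (m := m)
    rw [← hSdef] at hA'
    have bilG (i j : ℝ) := hA' (a ++ i :: z₁) (z ++ b) j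
    have bilF₁ (i j : ℝ) := hA' (a ++ z₁) (z ++ i :: b) j
    have bilF₂ (i j : ℝ) := hA' (a ++ z₁ ++ j :: z) b i
    simp only [List.append_assoc, List.cons_append] at bilG bilF₁ bilF₂ ⊢
    have := abs_bilinear_sub_le hx hu h₁₁ h₁₀ h₀₁ h₀₀
    convert this using 2
    rw [hA' a _ x, bilG 1 u, bilG 0 u, bilF₁ x u, bilF₂ x 1, bilF₂ x 0]
    ring
  · obtain ⟨h, a, rfl, hh⟩ := exists_append_of_le_length hak
    simp only [List.append_assoc] at hb ⊢
    rw [stepValue_append hh, stepValue_append hh]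
    refine abs_countExp_continuation_sub_le hβ hhi hcond
      (fun v hv => hI (hb.1 v (List.mem_append_left _ hv))) _ fun c _ => ?_
    have hN := isBelief_nextList (k := k) hp (t := a ++ (z ++ x :: b))
      (fun v hv => hI (hb.1 v (List.mem_append_right _
        ((List.perm_middle.append_left a).mem_iff.1 hv)))) c
    have e₁ : nextList p01 p11 k (a ++ (z ++ x :: b)) c =
        (List.replicate (k - c) p01 ++ (b.map (tau p01 p11)).reverse) ++
          tau p01 p11 x :: ((z.map (tau p01 p11)).reverse ++
            ((a.map (tau p01 p11)).reverse ++ List.replicate c p11)) := by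
      simp [nextList]
    have e₂ : nextList p01 p11 k (a ++ x :: (z ++ b)) c =
        (List.replicate (k - c) p01 ++ (b.map (tau p01 p11)).reverse) ++
          ((z.map (tau p01 p11)).reverse ++
            tau p01 p11 x :: ((a.map (tau p01 p11)).reverse ++ List.replicate c p11)) := by
      simp [nextList]
    rw [e₁] at hN ⊢
    rw [e₂, abs_sub_comm]
    exact hS _ _ _ _ hN

theorem exchangeMono_myopicValue (h0 : p01 ≤ 1) (h1 : 0 ≤ p11) (hp : p11 ≤ p01) (hβ : 0 ≤ β)
    (hlo : 0 ≤ lo) (hhi : 0 ≤ hi) (hcond : β * (lo + hi) ≤ lo)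
    (hr : ∀ h : List ℝ, (∀ v ∈ h, v ∈ Set.Icc p11 p01) → h.length + 1 = k →
      marginalReward m h ∈ Set.Icc lo hi) (s : ℕ) :
    ExchangeMono (Set.Icc p11 p01) k (myopicValue p01 p11 β k m s) := by
  suffices h : EntrywiseAffine (myopicValue p01 p11 β k m s) ∧
      ExchangeMono (Set.Icc p11 p01) k (myopicValue p01 p11 β k m s) ∧
      ShiftBound (Set.Icc p11 p01) k (lo + hi) (myopicValue p01 p11 β k m s) from h.2.1
  induction s with
  | zero =>
    refine ⟨fun _ _ _ => ?_, fun _ _ _ _ _ _ => le_rfl, fun _ _ _ _ _ => ?_⟩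
    · simp [myopicValue]
    · simpa [myopicValue] using add_nonneg hlo hhi
  | succ s ih =>
    obtain ⟨hA, hE, hS⟩ := ih
    exact ⟨hA.stepValue, hE.stepValue h0 h1 hp hβ hcond hr hA hS,
      hS.stepValue h0 h1 hp hβ hlo hhi hcond hr hA hE⟩

end Step

/-! ### Comparison of the policy values on vectors and on lists -/

theorem toFinset_take_finRange (N k : ℕ) :
    ((List.finRange N).take k).toFinset = senseSet N k := by
  ext i
  simp only [List.mem_toFinset, senseSet, Finset.mem_filter, Finset.mem_univ, true_and,
    List.mem_take_iff_getElem, List.getElem_finRange]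
  constructor
  · rintro ⟨j, hj, rfl⟩
    simp at hj ⊢
    omega
  · intro hi
    exact ⟨i, by simp; omega, by simp⟩

theorem sum_powerset_senseSet {N : ℕ} (k : ℕ) (ω : Fin N → ℝ) (g : ℕ → ℝ) :
    ∑ A ∈ (senseSet N k).powerset,
      (∏ i ∈ A, ω i) * (∏ i ∈ senseSet N k \ A, (1 - ω i)) * g A.card =
        countExp ((List.ofFn ω).take k) g := by
  rw [List.ofFn_eq_map, ← List.map_take, ← sum_powerset_eq_countExp _
    ((List.nodup_finRange N).sublist (List.take_sublist _ _)), toFinset_take_finRange]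

theorem card_senseSet {N k : ℕ} (hkN : k ≤ N) : (senseSet N k).card = k := by
  rw [← toFinset_take_finRange,
    List.toFinset_card_of_nodup ((List.nodup_finRange N).sublist (List.take_sublist _ _))]
  simpa using hkN

theorem ofFn_nextNeg (p01 p11 : ℝ) {N k c : ℕ} (hkN : k ≤ N) (hc : c ≤ k) (ω : Fin N → ℝ) :
    List.ofFn (nextNeg p01 p11 k ω c) = nextList p01 p11 k ((List.ofFn ω).drop k) c := by
  refine List.ext_getElem (by simp [nextList]; omega) fun i hi _ => ?_
  simp only [List.length_ofFn] at hi
  simp only [List.getElem_ofFn, nextNeg, nextList, List.getElem_append, List.length_replicate,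
    List.length_reverse, List.length_map, List.length_drop, List.length_ofFn,
    List.getElem_replicate, List.getElem_reverse, List.getElem_map, List.getElem_drop]
  split_ifs with h₁ h₂ h₃ h₄
  · rfl
  · congr 3
    omega
  · omega
  · omega
  · rfl

theorem Wneg_eq_myopicValue (p01 p11 β : ℝ) {N k : ℕ} (m : ℕ) (hkN : k ≤ N) (s : ℕ)
    (ω : Fin N → ℝ) :
    Wneg p01 p11 β N k m s ω = myopicValue p01 p11 β k m (s + 1) (List.ofFn ω) := by
  have hR (ω : Fin N → ℝ) : expReward m (senseSet N k) ω =
      countExp ((List.ofFn ω).take k) fun c => ((min c m : ℕ) : ℝ) :=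
    sum_powerset_senseSet k ω fun c => ((min c m : ℕ) : ℝ)
  induction s generalizing ω with
  | zero => simp [Wneg, hR, myopicValue, stepValue]
  | succ s ih =>
    rw [Wneg, hR, myopicValue, stepValue]
    have := countExp_lincomb ((List.ofFn ω).take k) 1 β (fun c => ((min c m : ℕ) : ℝ))
      fun c => myopicValue p01 p11 β k m (s + 1) (nextList p01 p11 k ((List.ofFn ω).drop k) c)
    simp only [one_mul] at this
    rw [this, ← sum_powerset_senseSet k ω fun c =>
      myopicValue p01 p11 β k m (s + 1) (nextList p01 p11 k ((List.ofFn ω).drop k) c)]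
    congr 2
    refine Finset.sum_congr rfl fun A hA => ?_
    have hAk : A.card ≤ k :=
      (Finset.card_le_card (Finset.mem_powerset.1 hA)).trans (card_senseSet hkN).le
    rw [ih, ofFn_nextNeg p01 p11 hkN hAk]

theorem pairwise_nextList {p01 p11 : ℝ} (hp : p11 ≤ p01) (k : ℕ) {t : List ℝ}
    (ht : ∀ v ∈ t, v ∈ Set.Icc (0 : ℝ) 1) (hs : t.Pairwise (· ≥ ·)) (c : ℕ) :
    (nextList p01 p11 k t c).Pairwise (· ≥ ·) := by
  have hmem : ∀ v ∈ nextList p01 p11 k t c, v ∈ Set.Icc p11 p01 :=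
    (isBelief_nextList (k := k) hp ht c).1
  rw [nextList] at hmem ⊢
  simp only [List.forall_mem_append] at hmem
  rw [List.pairwise_append, List.pairwise_append, List.pairwise_reverse, List.pairwise_map]
  refine ⟨by simp [List.pairwise_replicate], ⟨hs.imp fun h => tau_le_tau hp h,
    by simp [List.pairwise_replicate], fun a ha b hb => ?_⟩, fun a ha b hb => ?_⟩
  · rw [List.eq_of_mem_replicate hb]
    exact (hmem.2.1 a ha).1
  · rw [List.eq_of_mem_replicate ha]
    rcases List.mem_append.1 hb with hb | hb
    · exact (hmem.2.1 b hb).2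
    · exact (hmem.2.2 b hb).2

theorem map_ite_perm_replicate {ι : Type*} [DecidableEq ι] (l : List ι) (hl : l.Nodup)
    (B : Finset ι) (hB : B ⊆ l.toFinset) (x y : ℝ) :
    (l.map fun j => if j ∈ B then x else y).Perm
      (List.replicate (l.length - B.card) y ++ List.replicate B.card x) := by
  have hcard : (l.filter (· ∈ B)).length = B.card := by
    rw [← List.toFinset_card_of_nodup (hl.filter _), List.toFinset_filter]
    congr 1
    ext j
    simpa using fun hj => List.mem_toFinset.1 (hB hj)
  have hp := List.filter_append_perm (· ∈ B) l
  have hcard' := hp.length_eq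
  rw [List.length_append, hcard] at hcard'
  refine (hp.map _).symm.trans ?_
  rw [List.map_append]
  refine List.perm_append_comm.trans (List.Perm.of_eq ?_)
  congr 1 <;> rw [List.eq_replicate_iff]
  · refine ⟨by rw [List.length_map]; omega, fun v hv => ?_⟩
    obtain ⟨j, hj, rfl⟩ := List.mem_map.1 hv
    rw [if_neg (by simpa using (List.mem_filter.1 hj).2)]
  · refine ⟨by rw [List.length_map, hcard], fun v hv => ?_⟩
    obtain ⟨j, hj, rfl⟩ := List.mem_map.1 hv
    rw [if_pos (by simpa using (List.mem_filter.1 hj).2)]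

section Optimal

variable {p01 p11 β : ℝ} {N k m : ℕ} {U : (Fin N → ℝ) → ℝ} {V : List ℝ → ℝ}

/-- The value of sensing the channels in `π` and continuing with the value function `U`. -/
noncomputable def senseValue (p01 p11 β : ℝ) (m : ℕ) (U : (Fin N → ℝ) → ℝ) (ω : Fin N → ℝ)
    (π : Finset (Fin N)) : ℝ :=
  expReward m π ω + β * ∑ B ∈ π.powerset, (∏ i ∈ B, ω i) * (∏ i ∈ π \ B, (1 - ω i)) *
    U (fun j => if j ∈ B then p11 else if j ∈ π then p01 else tau p01 p11 (ω j))

theorem senseValue_toFinset (h0 : p01 ≤ 1) (h1 : 0 ≤ p11) (hp : p11 ≤ p01)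
    (hU : ∀ ω : Fin N → ℝ, (∀ i, ω i ∈ Set.Icc p11 p01) → ∀ L : List ℝ,
      L.Perm (List.ofFn ω) → L.Pairwise (· ≥ ·) → U ω = V L)
    {ω : Fin N → ℝ} (hω : ∀ i, ω i ∈ Set.Icc p11 p01) {l₁ l₂ : List (Fin N)}
    (hl : (l₁ ++ l₂).Perm (List.finRange N)) (hk : l₁.length = k)
    (hs : (l₂.map ω).Pairwise (· ≥ ·)) :
    senseValue p01 p11 β m U ω l₁.toFinset =
      stepValue p01 p11 β k m V (l₁.map ω ++ l₂.map ω) := by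
  have hI (i : Fin N) : ω i ∈ Set.Icc (0 : ℝ) 1 := Set.Icc_subset_Icc h1 h0 (hω i)
  have hnd : (l₁ ++ l₂).Nodup := hl.nodup_iff.2 (List.nodup_finRange N)
  obtain ⟨hnd₁, -, hdisj⟩ := List.nodup_append.1 hnd
  have ht : ∀ v ∈ l₂.map ω, v ∈ Set.Icc (0 : ℝ) 1 := by
    intro v hv
    obtain ⟨i, -, rfl⟩ := List.mem_map.1 hv
    exact hI i
  rw [stepValue_append (by simpa using hk)]
  have := countExp_lincomb (l₁.map ω) 1 β (fun c => ((min c m : ℕ) : ℝ))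
    fun c => V (nextList p01 p11 k (l₂.map ω) c)
  simp only [one_mul] at this
  rw [this, ← sum_powerset_eq_countExp _ hnd₁, ← sum_powerset_eq_countExp _ hnd₁, senseValue,
    expReward]
  congr 2
  refine Finset.sum_congr rfl fun B hB => ?_
  rw [Finset.mem_powerset] at hB
  congr 1
  refine hU _ (fun i => ?_) _ ?_ (pairwise_nextList hp k ht hs _)
  · split_ifs
    · exact ⟨le_rfl, hp⟩
    · exact ⟨hp, le_rfl⟩
    · exact tau_mem_Icc hp (hI i)
  · rw [List.ofFn_eq_map]
    refine List.Perm.trans ?_ (hl.map _)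
    rw [List.map_append]
    have e₁ : l₁.map (fun j => if j ∈ B then p11 else if j ∈ l₁.toFinset then p01
        else tau p01 p11 (ω j)) = l₁.map fun j => if j ∈ B then p11 else p01 :=
      List.map_congr_left fun j hj => by rw [if_pos (List.mem_toFinset.2 hj)]
    have e₂ : l₂.map (fun j => if j ∈ B then p11 else if j ∈ l₁.toFinset then p01
        else tau p01 p11 (ω j)) = (l₂.map ω).map (tau p01 p11) := by
      rw [List.map_map]
      refine List.map_congr_left fun j hj => ?_
      have hj₁ : j ∉ l₁.toFinset := fun h => hdisj j (List.mem_toFinset.1 h) j hj rfl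
      rw [if_neg fun h => hj₁ (hB h), if_neg hj₁, Function.comp_apply]
    rw [e₁, e₂, nextList]
    have hperm := map_ite_perm_replicate l₁ hnd₁ B hB p11 p01
    rw [hk] at hperm
    refine List.Perm.trans ?_ (hperm.symm.append_right _)
    rw [List.append_assoc]
    exact (List.perm_append_comm.trans ((List.reverse_perm _).append_left _)).append_left _

theorem exists_perm_pairwise_map (l : List (Fin N)) (ω : Fin N → ℝ) :
    ∃ l' : List (Fin N), l'.Perm l ∧ (l'.map ω).Pairwise (· ≥ ·) := by
  let r : Fin N → Fin N → Prop := fun i j => ω i ≥ ω j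
  let _ : DecidableRel r := Classical.decRel r
  have : Std.Total r := ⟨fun i j => le_total (ω j) (ω i)⟩
  have : IsTrans (Fin N) r := ⟨fun _ _ _ h h' => le_trans h' h⟩
  exact ⟨l.insertionSort r, List.perm_insertionSort r l,
    List.pairwise_map.2 (List.pairwise_insertionSort r l)⟩

theorem sSup_senseValue_eq (h0 : p01 ≤ 1) (h1 : 0 ≤ p11) (hp : p11 ≤ p01) (hkN : k ≤ N)
    (hU : ∀ ω : Fin N → ℝ, (∀ i, ω i ∈ Set.Icc p11 p01) → ∀ L : List ℝ,
      L.Perm (List.ofFn ω) → L.Pairwise (· ≥ ·) → U ω = V L)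
    (hE : ExchangeMono (Set.Icc p11 p01) k (stepValue p01 p11 β k m V))
    {ω : Fin N → ℝ} (hω : ∀ i, ω i ∈ Set.Icc p11 p01) {L : List ℝ} (hL : L.Perm (List.ofFn ω))
    (hs : L.Pairwise (· ≥ ·)) :
    sSup { r : ℝ | ∃ π : Finset (Fin N), π.card = k ∧ r = senseValue p01 p11 β m U ω π } =
      stepValue p01 p11 β k m V L := by
  refine IsGreatest.csSup_eq ⟨?_, ?_⟩
  · obtain ⟨l, hl, hls⟩ := exists_perm_pairwise_map (List.finRange N) ω
    have hlL : l.map ω = L :=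
      ((hl.map ω).trans (by rw [← List.ofFn_eq_map]; exact hL.symm)).eq_of_pairwise' hls hs
    have hlen : (l.take k).length = k := by
      simpa [hl.length_eq] using hkN
    have hnd : l.Nodup := hl.nodup_iff.2 (List.nodup_finRange N)
    refine ⟨(l.take k).toFinset, ?_, ?_⟩
    · rw [List.toFinset_card_of_nodup (hnd.sublist (List.take_sublist _ _)), hlen]
    · rw [senseValue_toFinset (k := k) h0 h1 hp hU hω (l₂ := l.drop k)
        (by rwa [List.take_append_drop]) hlen
        (hls.sublist ((List.drop_sublist _ _).map ω)), ← List.map_append,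
        List.take_append_drop, hlL]
  · rintro _ ⟨π, hπ, rfl⟩
    obtain ⟨l, hl, hls⟩ := exists_perm_pairwise_map (Finset.univ \ π).toList ω
    have hperm : (π.toList ++ l).Perm (List.finRange N) := by
      refine (hl.append_left _).trans ((List.perm_ext_iff_of_nodup ?_ (List.nodup_finRange N)).2
        fun i => ?_)
      · refine List.nodup_append.2 ⟨π.nodup_toList, Finset.nodup_toList _, ?_⟩
        rintro i hi j hj rfl
        simp only [Finset.mem_toList, Finset.mem_sdiff] at hi hj
        exact hj.2 hi
      · simpa using em _
    have hval := senseValue_toFinset (β := β) (m := m) (k := k) h0 h1 hp hU hω hperm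
      (by simpa using hπ) hls
    rw [Finset.toList_toFinset, ← List.map_append] at hval
    have hpermω : ((π.toList ++ l).map ω).Perm (List.ofFn ω) := by
      rw [List.ofFn_eq_map]
      exact hperm.map ω
    rw [hval]
    refine hE.le_of_perm (IsBelief.perm ⟨fun v hv => ?_, ?_⟩ hpermω.symm)
      (hpermω.trans hL.symm) hs
    · obtain ⟨i, rfl⟩ := List.mem_ofFn.1 hv
      exact hω i
    · simpa using hkN

theorem Vopt_eq_myopicValue (h0 : p01 ≤ 1) (h1 : 0 ≤ p11) (hp : p11 ≤ p01) (hkN : k ≤ N)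
    (hE : ∀ s, ExchangeMono (Set.Icc p11 p01) k (myopicValue p01 p11 β k m s)) (s : ℕ)
    (ω : Fin N → ℝ) (hω : ∀ i, ω i ∈ Set.Icc p11 p01) (L : List ℝ) (hL : L.Perm (List.ofFn ω))
    (hs : L.Pairwise (· ≥ ·)) :
    Vopt p01 p11 β N k m s ω = myopicValue p01 p11 β k m (s + 1) L := by
  induction s generalizing ω L with
  | zero =>
    rw [myopicValue, ← sSup_senseValue_eq (U := 0) (V := myopicValue p01 p11 β k m 0) h0 h1 hp hkN (fun _ _ _ _ _ => rfl) (hE 1) hω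
      hL hs]
    simp [Vopt, senseValue]
  | succ s ih =>
    rw [myopicValue, ← sSup_senseValue_eq h0 h1 hp hkN ih (hE (s + 2)) hω hL hs]
    rfl

end Optimal

/-- optimality of myopic sensing for the finite-horizon
discounted problem with negatively correlated channels, under
`β·(ℛ̲ + ℛ̄) ≤ ℛ̲`. -/
theorem myopic_optimal_negative (p01 p11 β : ℝ) (h0 : p01 ∈ Set.Icc (0 : ℝ) 1)
    (h1 : p11 ∈ Set.Icc (0 : ℝ) 1) (hp : p11 ≤ p01)
    (N k m T : ℕ) (hm : 1 ≤ m) (hmk : m ≤ k) (hkN : k ≤ N) (hT : 1 ≤ T)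
    (hβ0 : 0 ≤ β)
    (hcond : β * (Rlow p11 p01 m (k - 1) + Rbar p11 p01 m (k - 1)) ≤
      Rlow p11 p01 m (k - 1)) :
    ∀ t, 1 ≤ t → t ≤ T → ∀ ω : Fin N → ℝ,
      (∀ i, ω i ∈ Set.Icc p11 p01) → Antitone ω →
      Wneg p01 p11 β N k m (T - t) ω = Vopt p01 p11 β N k m (T - t) ω := by
  intro t _ _ ω hω hanti
  have hr : ∀ h : List ℝ, (∀ v ∈ h, v ∈ Set.Icc p11 p01) → h.length + 1 = k →
      marginalReward m h ∈ Set.Icc (Rlow p11 p01 m (k - 1)) (Rbar p11 p01 m (k - 1)) := by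
    rintro h hh rfl
    exact marginalReward_mem_Icc_Rlow_Rbar h1.1 h0.2 m hh
  have hsorted : (List.ofFn ω).Pairwise (· ≥ ·) :=
    List.pairwise_ofFn.2 fun _ _ hij => hanti hij.le
  rw [Wneg_eq_myopicValue p01 p11 β m hkN, Vopt_eq_myopicValue h0.2 h1.1 hp hkN
    (exchangeMono_myopicValue h0.2 h1.1 hp hβ0 (Rlow_nonneg h1.1 h0.2 m _)
      (Rbar_nonneg h1.1 h0.2 m _) hcond hr) (T - t) ω hω _ (List.Perm.refl _) hsorted]
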